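/- Fix integers m ≥ 1, n ≥ 2 and let i ∈ {1, …, n−1}. Then for every A ∈ Ξ^{ı,0}_{m|n,n}: (1) t^{(A)} B^R_i B^R_i = 0; (2) the composite C_i sending x to (x B^R_i) B^R_{−i} maps 𝒱^{ı,0}_{m|n,n} into itself, with C_i(t^{(A_λ)}) = t^{(A_{λ·s_i})} + q·t^{(A_λ)} if λ_i < λ_{i+1}, C_i(t^{(A_λ)}) = (q+q^{−1})·t^{(A_λ)} if λ_i = λ_{i+1}, and C_i(t^{(A_λ)}) = t^{(A_{λ·s_i})} + q^{−1}·t^{(A_λ)} if λ_i > λ_{i+1}, where λ·s_i interchanges λ_i and λ_{i+1}; (3) for T_i := id − q^{−1} C_i on 𝒱^{ı,0}_{m|n,n} one has (−q)·T_i(Λ^ı(v_λ)) = Λ^ı(σ_i(v_λ)) for every λ ∈ 𝕀_{2m}^n, and (T_i + q^{−2}·id)(T_i − id) = 0. (Hence the relative braid group symmetry 𝐓_i acts on the ı-weight ρ̄ space by the Hecke algebra generator, up to the scalar −q.) -/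

import Mathlib

open scoped BigOperators Classical

noncomputable section

/-- The base field `ℚ(q)`. -/
abbrev K : Type := RatFunc ℚ

/-- The indeterminate `q`. -/
def q : K := RatFunc.X

/-- The quantum integer `[r] = (q^r - q^{-r})/(q - q^{-1})`. -/
def qint (r : ℤ) : K := (q ^ r - q ^ (-r)) / (q - q⁻¹)

/-- The quantum factorial `[r]!`. -/
def qfac : ℕ → K
  | 0 => 1
  | n+1 => qfac n * qint (n+1)

/-- The index set `𝕀_N = {-(N-1)/2, -(N-3)/2, …, (N-1)/2}` as a finite set of rationals. -/
def II (N : ℕ) : Finset ℚ := (Finset.range N).image (fun k : ℕ => (k : ℚ) - ((N : ℚ) - 1) / 2)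

theorem II_neg {N : ℕ} {a : ℚ} (h : a ∈ II N) : -a ∈ II N := by
  obtain ⟨k, hk, hv⟩ := Finset.mem_image.mp h
  rw [Finset.mem_range] at hk
  refine Finset.mem_image.mpr ⟨N - 1 - k, Finset.mem_range.mpr (by omega), ?_⟩
  have h1 : ((N - 1 - k : ℕ) : ℚ) = (N : ℚ) - 1 - (k : ℚ) := by
    have h2 : (N : ℚ) = ((N - 1 - k : ℕ) : ℚ) + (k : ℚ) + 1 := by
      exact_mod_cast congrArg (Nat.cast : ℕ → ℚ) (by omega : N = (N - 1 - k) + k + 1)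
    linarith
  rw [h1, ← hv]; ring

/-- Matrices with rational row/column labels and natural number entries. -/
abbrev Mat : Type := ℚ → ℚ → ℕ

/-- The θ-elementary matrix `E^θ_{r,c} = E_{r,c} + E_{-r,-c}`. -/
def chiM (r c : ℚ) : Mat := fun x y =>
  (if x = r ∧ y = c then 1 else 0) + (if x = -r ∧ y = -c then 1 else 0)

/-- `A + E^θ_{p,j} - E^θ_{p',j'}` (truncated ℕ-subtraction; only used where the
corresponding q-integer coefficient vanishes otherwise). -/
def matMove (A : Mat) (p j p' j' : ℚ) : Mat := fun x y => A x y + chiM p j x y - chiM p' j' x y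

/-- Free `ℚ(q)`-vector space on the set of matrices `P`. -/
abbrev FM (P : Set Mat) : Type := {A : Mat // A ∈ P} →₀ K

/-- Basis vector `t^{(A)}` (zero if `A ∉ P`). -/
def tP (P : Set Mat) (A : Mat) : FM P := if h : A ∈ P then Finsupp.single ⟨A, h⟩ 1 else 0

/-- Linear operator on `FM P` defined by its values on basis vectors. -/
def opOf {P : Set Mat} (f : Mat → FM P) : FM P →ₗ[K] FM P :=
  Finsupp.lift (FM P) K {A : Mat // A ∈ P} fun A => f A.1

/-- The set `Ξ^ı_{m|n,d}`: matrices supported on `𝕀_{2m} × 𝕀_{2n}`, centro-symmetric,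
with total entry sum `2d`. -/
def Xiι (m n d : ℕ) : Set Mat :=
  {A | (∀ i j, A i j ≠ 0 → i ∈ II (2*m) ∧ j ∈ II (2*n)) ∧
       (∀ i j, A i j = A (-i) (-j)) ∧
       ∑ i ∈ II (2*m), ∑ j ∈ II (2*n), A i j = 2*d}

/-- Left operator `B^L_i` (ı-case), for `i ∈ 𝕀_{2m-1}`, `i ≠ 0`. -/
def BLι (n : ℕ) (P : Set Mat) (i : ℚ) : FM P →ₗ[K] FM P :=
  opOf fun A => ∑ j ∈ II (2*n),
    (q ^ ((∑ k ∈ (II (2*n)).filter (fun k => j ≤ k), ((A (i+1/2) k : ℤ) - (A (i-1/2) k : ℤ))) + 1)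
      * qint (A (i-1/2) j)) • tP P (matMove A (i+1/2) j (i-1/2) j)

/-- Left operator `B^L_0` (ı-case). -/
def BL0ι (n : ℕ) (P : Set Mat) : FM P →ₗ[K] FM P :=
  opOf fun A =>
    (∑ j ∈ II (2*n),
      (q ^ ((∑ k ∈ (II (2*n)).filter (fun k => j ≤ k), ((A (1/2) k : ℤ) - (A (-(1/2)) k : ℤ)))
            + (if 0 < j then 1 else 0))
        * qint (A (-(1/2)) j)) • tP P (matMove A (1/2) j (-(1/2)) j))
    + (q ^ (∑ j ∈ (II (2*n)).filter (fun j => 0 < j), ((A (1/2) j : ℤ) - (A (-(1/2)) j : ℤ)))) • tP P A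

/-- Left Cartan operator `(d^L_r)^e` for `e = ±1` (ı-case). -/
def dLι (n : ℕ) (P : Set Mat) (r : ℚ) (e : ℤ) : FM P →ₗ[K] FM P :=
  opOf fun A => (q ^ (e * ∑ j ∈ II (2*n), (A r j : ℤ))) • tP P A

/-- Right operator `B^R_i` (ı-case), for `i ∈ 𝕀_{2n-1}`, `i ≠ 0`. -/
def BRι (m : ℕ) (P : Set Mat) (i : ℚ) : FM P →ₗ[K] FM P :=
  opOf fun A => ∑ j ∈ II (2*m),
    (q ^ (∑ k ∈ (II (2*m)).filter (fun k => j < k), ((A k (i+1/2) : ℤ) - (A k (i-1/2) : ℤ)))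
      * qint (A j (i+1/2))) • tP P (matMove A j (i-1/2) j (i+1/2))

/-- Right operator `B^R_0` (ı-case). -/
def BR0ι (m : ℕ) (P : Set Mat) : FM P →ₗ[K] FM P :=
  opOf fun A =>
    (∑ j ∈ II (2*m),
      (q ^ ((∑ k ∈ (II (2*m)).filter (fun k => j < k), ((A k (1/2) : ℤ) - (A k (-(1/2)) : ℤ)))
            + (if j < 0 then 1 else 0))
        * qint (A j (1/2))) • tP P (matMove A j (-(1/2)) j (1/2)))
    + (q ^ (∑ j ∈ (II (2*m)).filter (fun j => 0 < j), ((A j (1/2) : ℤ) - (A j (-(1/2)) : ℤ)))) • tP P A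

/-- Right Cartan operator `(d^R_r)^e` for `e = ±1` (ı-case). -/
def dRι (m : ℕ) (P : Set Mat) (r : ℚ) (e : ℤ) : FM P →ₗ[K] FM P :=
  opOf fun A => (q ^ (e * ∑ k ∈ II (2*m), (A k r : ℤ))) • tP P A

/-- The subset `Ξ^{ı,0}_{m|n,n}` (all column sums equal to `1`). -/
def Xi0ι (m n : ℕ) : Set Mat :=
  {A | A ∈ Xiι m n n ∧ ∀ j ∈ II (2*n), ∑ i ∈ II (2*m), A i j = 1}

/-- The ı-weight `ρ̄` subspace `𝒱^{ı,0}_{m|n,n}`. -/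
def V0ι (m n : ℕ) : Submodule K (FM (Xiι m n n)) :=
  Submodule.span K {v | ∃ A ∈ Xi0ι m n, v = tP (Xiι m n n) A}

/-- Basis index of `V`: elements of `𝕀_M`. -/
def SubI (M : ℕ) : Type := {a : ℚ // a ∈ II M}

/-- `V^{⊗n}`: free `ℚ(q)`-vector space on `n`-tuples from `𝕀_M`. -/
abbrev TV (n M : ℕ) : Type := (Fin n → SubI M) →₀ K

/-- Basis vector `v_λ`. -/
def tT {n M : ℕ} (l : Fin n → SubI M) : TV n M := Finsupp.single l 1

/-- A "single-target" operator on `V`: `v_a ↦ c a • v_{t a}`. -/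
structure SOp where
  t : ℚ → ℚ
  c : ℚ → K

def SOp.id' : SOp := ⟨fun a => a, fun _ => 1⟩
/-- Composite `O ∘ P`. -/
def SOp.comp (O P : SOp) : SOp := ⟨fun a => O.t (P.t a), fun a => P.c a * O.c (P.t a)⟩
/-- `E_i v_a = δ(a = i+1/2) v_{a-1}`. -/
def Eop (i : ℚ) : SOp := ⟨fun a => a - 1, fun a => if a = i + 1/2 then 1 else 0⟩
/-- `F_i v_a = δ(a = i-1/2) v_{a+1}`. -/
def Fop (i : ℚ) : SOp := ⟨fun a => a + 1, fun a => if a = i - 1/2 then 1 else 0⟩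
/-- A diagonal operator `v_a ↦ q^{f a} v_a`. -/
def diagOp (f : ℚ → ℤ) : SOp := ⟨fun a => a, fun a => q ^ f a⟩
/-- `K_i^{-1}` (diagonal). -/
def Kinv (i : ℚ) : SOp := diagOp fun a => (if a = i+1/2 then 1 else 0) - (if a = i-1/2 then 1 else 0)
/-- `K_i` (diagonal). -/
def Kpos (i : ℚ) : SOp := diagOp fun a => (if a = i-1/2 then 1 else 0) - (if a = i+1/2 then 1 else 0)
/-- `k_i^{-1} = K_i^{-1} K_{-i}`. -/
def kinv (i : ℚ) : SOp := (Kinv i).comp (Kpos (-i))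
/-- `k_i = K_i K_{-i}^{-1}`. -/
def kpos (i : ℚ) : SOp := (Kpos i).comp (Kinv (-i))
/-- `(D_r D_{-r})^e` (diagonal), `e = ±1`. -/
def DDop (r : ℚ) (e : ℤ) : SOp := diagOp fun a => e * ((if a = r then 1 else 0) + (if a = -r then 1 else 0))
/-- `D_0^e` (diagonal), `e = ±1`. -/
def D0op (e : ℤ) : SOp := diagOp fun a => e * (if a = 0 then 1 else 0)

/-- Tensor product `ops 0 ⊗ ops 1 ⊗ ⋯ ⊗ ops (n-1)` of single-target operators on `V^{⊗n}`. -/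
def tensorOp {n M : ℕ} (ops : Fin n → SOp) : TV n M →ₗ[K] TV n M :=
  Finsupp.lift (TV n M) K (Fin n → SubI M) fun l =>
    if h : ∀ r, (ops r).t (l r).1 ∈ II M then
      Finsupp.single (fun r => ⟨(ops r).t (l r).1, h r⟩) (∏ r, (ops r).c (l r).1)
    else 0

/-- `𝓑_i` on `V^{⊗n}`, for `i ≠ 0` (ı-case) resp. `i ∈ {1/2,…,m-1/2}` (ȷ-case). -/
def calB (n M : ℕ) (i : ℚ) : TV n M →ₗ[K] TV n M :=
  (∑ r : Fin n, tensorOp fun s => if s < r then SOp.id' else if s = r then Fop i else Kinv i)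
  + (∑ r : Fin n, tensorOp fun s => if s < r then kinv i else if s = r then (Eop (-i)).comp (Kinv i) else Kinv i)

/-- `𝓑_0` on `V^{⊗n}` (ı-case). -/
def calB0 (n M : ℕ) : TV n M →ₗ[K] TV n M :=
  (∑ r : Fin n, tensorOp fun s => if s < r then SOp.id' else if s = r then Fop 0 else Kinv 0)
  + q⁻¹ • (∑ r : Fin n, tensorOp fun s => if s < r then SOp.id' else if s = r then (Eop 0).comp (Kinv 0) else Kinv 0)
  + tensorOp fun _ => Kinv 0

/-- `𝓑_{-i}` on `V^{⊗n}` (ȷ-case), for `i ∈ {1/2,…,m-1/2}`. -/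
def calBn (n M : ℕ) (i : ℚ) : TV n M →ₗ[K] TV n M :=
  (∑ r : Fin n, tensorOp fun s => if s < r then SOp.id' else if s = r then Fop (-i) else Kinv (-i))
  + (∑ r : Fin n, tensorOp fun s => if s < r then kpos i else if s = r then (Kinv (-i)).comp (Eop i) else Kinv (-i))

/-- `𝓓_r^e = ((D_r D_{-r})^e)^{⊗n}`. -/
def calD (n M : ℕ) (r : ℚ) (e : ℤ) : TV n M →ₗ[K] TV n M := tensorOp fun _ => DDop r e

/-- `𝓓_0^e = (D_0^e)^{⊗n}`. -/
def calD0 (n M : ℕ) (e : ℤ) : TV n M →ₗ[K] TV n M := tensorOp fun _ => D0op e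

/-- Negation on `𝕀_M`. -/
def negS {M : ℕ} (a : SubI M) : SubI M := ⟨-a.1, II_neg a.2⟩

/-- `λ · s` where `s` interchanges the tensor positions `a` and `b`. -/
def swapL {n M : ℕ} (a b : Fin n) (l : Fin n → SubI M) : Fin n → SubI M := l ∘ Equiv.swap a b

/-- The Hecke operator `σ` acting in tensor positions `a, b` (for `a < b` adjacent). -/
def sigmaI {n M : ℕ} (a b : Fin n) : TV n M →ₗ[K] TV n M :=
  Finsupp.lift (TV n M) K (Fin n → SubI M) fun l =>
    if (l a).1 < (l b).1 then tT (swapL a b l)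
    else if (l a).1 = (l b).1 then q⁻¹ • tT l
    else tT (swapL a b l) + (q⁻¹ - q) • tT l

/-- The Hecke operator `σ_0`. -/
def sigma0 {n M : ℕ} (hn : 0 < n) : TV n M →ₗ[K] TV n M :=
  Finsupp.lift (TV n M) K (Fin n → SubI M) fun l =>
    if 0 < (l ⟨0, hn⟩).1 then tT (Function.update l ⟨0, hn⟩ (negS (l ⟨0, hn⟩)))
    else if (l ⟨0, hn⟩).1 = 0 then q⁻¹ • tT l
    else tT (Function.update l ⟨0, hn⟩ (negS (l ⟨0, hn⟩))) + (q⁻¹ - q) • tT l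

/-- `σ_i`, `0 ≤ i ≤ n-1` (for `i ≥ 1` it acts on the 1-based entries `λ_i, λ_{i+1}`). -/
def sigmaB {n M : ℕ} (hn : 0 < n) (i : ℕ) (hi : i < n) : TV n M →ₗ[K] TV n M :=
  if i = 0 then sigma0 hn else sigmaI ⟨i - 1, by omega⟩ ⟨i, hi⟩

/-- The 0-1 matrix `A_λ` (ı-case): column `j - 1/2` is `e_{λ_j}` and column `-(j - 1/2)`
is `e_{-λ_j}`, for `j = 1, …, n` (here `j : Fin n` is 0-based, so column `j + 1/2`). -/
def Aι {n : ℕ} (l : Fin n → ℚ) : Mat := fun x y =>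
  ∑ j : Fin n, ((if y = (j : ℚ) + 1/2 ∧ x = l j then 1 else 0)
              + (if y = -((j : ℚ) + 1/2) ∧ x = -(l j) then 1 else 0))

/-- The linear map `Λ^ı : V^{⊗n} → 𝒱^ı_{m|n,n}`, `v_λ ↦ t^{(A_λ)}`. -/
def Lamι (m n : ℕ) : TV n (2*m) →ₗ[K] FM (Xiι m n n) :=
  Finsupp.lift (FM (Xiι m n n)) K (Fin n → SubI (2*m)) fun l =>
    tP (Xiι m n n) (Aι fun r => (l r).1)

/-- The composite `C_i : x ↦ (x B^R_i) B^R_{-i}` on `𝒱^ı_{m|n,n}`. -/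
def Ciι (m n : ℕ) (i : ℚ) : Module.End K (FM (Xiι m n n)) :=
  (BRι m (Xiι m n n) (-i) : Module.End K (FM (Xiι m n n))) * BRι m (Xiι m n n) i

/-- The operator `T_i = id - q^{-1} C_i`. -/
def Tiι (m n : ℕ) (i : ℚ) : Module.End K (FM (Xiι m n n)) := 1 - q⁻¹ • Ciι m n i

theorem q_ne_zero : q ≠ 0 := RatFunc.X_ne_zero

theorem q_sub_inv_ne_zero : q - q⁻¹ ≠ 0 := by
  have hdeg : (q ^ 2).intDegree = 2 := by
    rw [q, sq, RatFunc.intDegree_mul RatFunc.X_ne_zero RatFunc.X_ne_zero, RatFunc.intDegree_X]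
    norm_num
  intro h
  have h2 : q ^ 2 = 1 := by
    have := q_ne_zero
    rw [sq]
    nth_rewrite 2 [sub_eq_zero.mp h]
    exact mul_inv_cancel₀ this
  rw [h2, RatFunc.intDegree_one] at hdeg
  norm_num at hdeg

@[simp] theorem qint_zero : qint 0 = 0 := by simp [qint]

@[simp] theorem qint_one : qint 1 = 1 := by
  rw [qint, zpow_neg, zpow_one, div_self q_sub_inv_ne_zero]

theorem qint_two : qint 2 = q + q⁻¹ := by
  rw [qint, div_eq_iff q_sub_inv_ne_zero, zpow_neg]
  norm_cast
  rw [← inv_pow]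
  ring

theorem tP_mem_span {m n : ℕ} {A : Mat} (hA : A ∈ Xi0ι m n) : tP (Xiι m n n) A ∈ V0ι m n :=
  Submodule.subset_span ⟨A, hA, rfl⟩

theorem BRι_tP {m : ℕ} {P : Set Mat} (i : ℚ) {A : Mat} (hA : A ∈ P) :
    BRι m P i (tP P A) = ∑ j ∈ II (2*m),
      (q ^ (∑ k ∈ (II (2*m)).filter (fun k => j < k), ((A k (i+1/2) : ℤ) - (A k (i-1/2) : ℤ)))
        * qint (A j (i+1/2))) • tP P (matMove A j (i-1/2) j (i+1/2)) := by
  simp [BRι, opOf, tP, hA]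

/-- The symmetrised matrix `∑ⱼ E^θ_{l j, c j}`. -/
def thetaSum {n : ℕ} (l c : Fin n → ℚ) : Mat := fun x y => ∑ j, chiM (l j) (c j) x y

/-- The positive column labels `1/2, 3/2, …, n - 1/2`. -/
def stdCol (n : ℕ) (j : Fin n) : ℚ := (j : ℚ) + 1/2

theorem stdCol_pos {n : ℕ} (j : Fin n) : 0 < stdCol n j := by
  unfold stdCol; positivity

theorem stdCol_injective (n : ℕ) : Function.Injective (stdCol n) := by
  intro j k h
  simpa [stdCol, Fin.ext_iff] using h

theorem stdCol_mem {n : ℕ} (j : Fin n) : stdCol n j ∈ II (2*n) := by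
  refine Finset.mem_image.mpr ⟨n + j, Finset.mem_range.mpr (by omega), ?_⟩
  simp only [stdCol]; push_cast; ring

theorem exists_stdCol {n : ℕ} {y : ℚ} (hy : y ∈ II (2*n)) :
    ∃ j, y = stdCol n j ∨ y = -stdCol n j := by
  obtain ⟨k, hk, rfl⟩ := Finset.mem_image.mp hy
  rw [Finset.mem_range] at hk
  rcases le_or_gt n k with h | h
  · obtain ⟨j, rfl⟩ := Nat.exists_eq_add_of_le h
    refine ⟨⟨j, by omega⟩, Or.inl ?_⟩
    simp only [stdCol]; push_cast; ring
  · obtain ⟨j, rfl⟩ := Nat.exists_eq_add_of_lt h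
    refine ⟨⟨j, by omega⟩, Or.inr ?_⟩
    simp only [stdCol]; push_cast; ring

theorem Aι_eq_thetaSum {n : ℕ} (l : Fin n → ℚ) : Aι l = thetaSum l (stdCol n) := by
  funext x y
  simp only [Aι, thetaSum, chiM, stdCol, and_comm (a := y = _)]
  congr!

theorem chiM_neg (r c x y : ℚ) : chiM r c (-x) (-y) = chiM r c x y := by
  simp only [chiM, neg_eq_iff_eq_neg, neg_neg]
  exact add_comm (if x = -r ∧ y = -c then 1 else 0) _

theorem chiM_neg_neg (r c : ℚ) : chiM (-r) (-c) = chiM r c := by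
  funext x y
  simp only [chiM, neg_neg]
  exact add_comm (if x = -r ∧ y = -c then 1 else 0) _

theorem chiM_of_pos {c y : ℚ} (r x : ℚ) (hc : 0 < c) (hy : 0 < y) :
    chiM r c x y = if x = r ∧ y = c then 1 else 0 := by
  have : y ≠ -c := by linarith
  simp [chiM, this]

theorem thetaSum_neg {n : ℕ} (l c : Fin n → ℚ) (x y : ℚ) :
    thetaSum l c (-x) (-y) = thetaSum l c x y := by
  simp only [thetaSum, chiM_neg]

theorem thetaSum_mem {m n : ℕ} {l c : Fin n → ℚ} (hl : ∀ j, l j ∈ II (2*m))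
    (hc : ∀ j, c j ∈ II (2*n)) : thetaSum l c ∈ Xiι m n n := by
  refine ⟨fun x y h => ?_, fun x y => (thetaSum_neg l c x y).symm, ?_⟩
  · obtain ⟨j, -, hj⟩ := Finset.exists_ne_zero_of_sum_ne_zero h
    have : (x = l j ∧ y = c j) ∨ (x = -l j ∧ y = -c j) := by
      by_contra! hn
      refine hj ?_
      rw [chiM, if_neg fun h => hn.1 h.1 h.2, if_neg fun h => hn.2 h.1 h.2, add_zero]
    rcases this with ⟨rfl, rfl⟩ | ⟨rfl, rfl⟩
    · exact ⟨hl j, hc j⟩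
    · exact ⟨II_neg (hl j), II_neg (hc j)⟩
  · have key : ∀ j, ∑ x ∈ II (2*m), ∑ y ∈ II (2*n), chiM (l j) (c j) x y = 2 := by
      intro j
      simp [chiM, Finset.sum_add_distrib, ite_and, hl j, hc j, II_neg (hl j), II_neg (hc j)]
    calc ∑ x ∈ II (2*m), ∑ y ∈ II (2*n), ∑ j, chiM (l j) (c j) x y
        = ∑ j, ∑ x ∈ II (2*m), ∑ y ∈ II (2*n), chiM (l j) (c j) x y := by
          rw [Finset.sum_comm]
          conv_rhs => enter [2, j]; rw [Finset.sum_comm]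
          rw [Finset.sum_comm (s := Finset.univ)]
          refine Finset.sum_congr rfl fun y _ => Finset.sum_comm
      _ = 2*n := by simp only [key]; simp [mul_comm]

theorem matMove_thetaSum {n : ℕ} (l c : Fin n → ℚ) (k : Fin n) (y : ℚ) :
    matMove (thetaSum l c) (l k) y (l k) (c k) = thetaSum l (Function.update c k y) := by
  funext x z
  have h : ∀ c' : Fin n → ℚ, thetaSum l c' x z =
      chiM (l k) (c' k) x z + ∑ j ∈ Finset.univ.erase k, chiM (l j) (c' j) x z := fun c' =>
    (Finset.add_sum_erase _ _ (Finset.mem_univ k)).symm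
  have h2 : ∑ j ∈ Finset.univ.erase k, chiM (l j) (Function.update c k y j) x z
      = ∑ j ∈ Finset.univ.erase k, chiM (l j) (c j) x z :=
    Finset.sum_congr rfl fun j hj => by
      rw [Function.update_of_ne (Finset.ne_of_mem_erase hj)]
  rw [matMove, h c, h (Function.update c k y), h2, Function.update_self]
  omega

theorem matMove_neg (A : Mat) (p j p' j' : ℚ) :
    matMove A (-p) (-j) (-p') (-j') = matMove A p j p' j' := by
  funext x y
  simp only [matMove, chiM_neg_neg]

theorem thetaSum_comp_perm {n : ℕ} (l c : Fin n → ℚ) (e : Equiv.Perm (Fin n)) :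
    thetaSum (l ∘ e) (c ∘ e) = thetaSum l c := by
  funext x y
  exact Equiv.sum_comp e fun j => chiM (l j) (c j) x y

theorem thetaSum_stdCol {n : ℕ} (l : Fin n → ℚ) (x : ℚ) (k : Fin n) :
    thetaSum l (stdCol n) x (stdCol n k) = if x = l k then 1 else 0 := by
  have key : ∀ j, chiM (l j) (stdCol n j) x (stdCol n k) =
      if j = k then (if x = l k then 1 else 0) else 0 := by
    intro j
    rw [chiM_of_pos _ _ (stdCol_pos j) (stdCol_pos k)]
    by_cases hjk : j = k
    · subst hjk; simp
    · simp [(stdCol_injective n).eq_iff, hjk, Ne.symm hjk]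
  simp [thetaSum, key]

theorem thetaSum_merge {n : ℕ} (l : Fin n → ℚ) (x : ℚ) {a b : Fin n} (hab : a ≠ b) (k : Fin n) :
    thetaSum l (Function.update (stdCol n) b (stdCol n a)) x (stdCol n k) =
      if k = b then 0 else if k = a then (if x = l a then 1 else 0) + (if x = l b then 1 else 0)
      else if x = l k then 1 else 0 := by
  have hpos : ∀ j, 0 < Function.update (stdCol n) b (stdCol n a) j := by
    intro j
    rcases eq_or_ne j b with rfl | h
    · simpa using stdCol_pos a
    · simpa [h] using stdCol_pos j
  have key : ∀ j, chiM (l j) (Function.update (stdCol n) b (stdCol n a) j) x (stdCol n k) =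
      (if j = k then (if k ≠ b ∧ x = l k then 1 else 0) else 0)
        + (if j = b then (if k = a ∧ x = l b then 1 else 0) else 0) := by
    intro j
    rw [chiM_of_pos _ _ (hpos j) (stdCol_pos k)]
    rcases eq_or_ne j b with rfl | h
    · simp only [Function.update_self, (stdCol_injective n).eq_iff]
      by_cases hjk : j = k
      · subst hjk; simp [hab.symm]
      · simp [hjk, and_comm]
    · simp only [Function.update_of_ne h, (stdCol_injective n).eq_iff]
      by_cases hjk : j = k
      · subst hjk; simp [h]
      · simp [h, hjk, Ne.symm hjk]
  simp only [thetaSum, key, Finset.sum_add_distrib, Finset.sum_ite_eq', Finset.mem_univ, if_true]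
  by_cases hkb : k = b
  · subst hkb; simp [hab.symm]
  · by_cases hka : k = a
    · subst hka; simp [hkb]
    · simp [hkb, hka]

theorem sum_filter_lt_ite {M : ℕ} {a : ℚ} (j : ℚ) (ha : a ∈ II M) :
    ∑ k ∈ (II M).filter (fun k => j < k), (if k = a then 1 else 0 : ℤ) = if j < a then 1 else 0 := by
  simp [Finset.sum_ite_eq', ha]

section RightOperator

variable {m n : ℕ} {l : Fin n → ℚ} {a b : Fin n} {i : ℚ}

theorem BRι_stdCol (hl : ∀ j, l j ∈ II (2*m))
    (ha : i - 1/2 = stdCol n a) (hb : i + 1/2 = stdCol n b) :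
    BRι m (Xiι m n n) i (tP _ (thetaSum l (stdCol n))) =
      (q ^ (if l b < l a then -1 else 0 : ℤ)) •
        tP _ (thetaSum l (Function.update (stdCol n) b (stdCol n a))) := by
  rw [BRι_tP i (thetaSum_mem hl stdCol_mem), Finset.sum_eq_single (l b)]
  · rw [ha, hb, matMove_thetaSum]
    simp only [thetaSum_stdCol]
    push_cast
    rw [Finset.sum_sub_distrib, sum_filter_lt_ite _ (hl a), sum_filter_lt_ite _ (hl b)]
    congr 1
    split_ifs <;> simp_all
  · intro j _ hj
    rw [hb, thetaSum_stdCol]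
    simp [hj]
  · exact fun h => absurd (hl b) h

theorem update_stdCol_mem (a b : Fin n) (j : Fin n) :
    Function.update (stdCol n) b (stdCol n a) j ∈ II (2*n) := by
  rcases eq_or_ne j b with rfl | h
  · simpa using stdCol_mem a
  · simpa [h] using stdCol_mem j

theorem BRι_merge (hl : ∀ j, l j ∈ II (2*m)) (hab : a ≠ b) (hb : i + 1/2 = stdCol n b) :
    BRι m (Xiι m n n) i (tP _ (thetaSum l (Function.update (stdCol n) b (stdCol n a)))) = 0 := by
  rw [BRι_tP i (thetaSum_mem hl (update_stdCol_mem a b))]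
  refine Finset.sum_eq_zero fun j _ => ?_
  rw [hb, thetaSum_merge _ _ hab]
  simp

theorem update_merge_left (a b : Fin n) :
    Function.update (Function.update (stdCol n) b (stdCol n a)) a (stdCol n b)
      = stdCol n ∘ Equiv.swap a b := by
  funext j
  simp only [Function.update_apply, Function.comp, Equiv.swap_apply_def]
  split_ifs <;> rfl

theorem BRι_neg_merge (hl : ∀ j, l j ∈ II (2*m)) (hab : a ≠ b)
    (ha : i - 1/2 = stdCol n a) (hb : i + 1/2 = stdCol n b) :
    BRι m (Xiι m n n) (-i)
        (tP _ (thetaSum l (Function.update (stdCol n) b (stdCol n a)))) =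
      if l a = l b then (q + q⁻¹) • tP _ (thetaSum l (stdCol n))
      else (q ^ (if l b < l a then 1 else 0 : ℤ)) •
          tP _ (thetaSum (l ∘ Equiv.swap a b) (stdCol n)) +
        (q ^ (if l a < l b then 1 else 0 : ℤ)) • tP _ (thetaSum l (stdCol n)) := by
  have ha' : -i + 1/2 = -stdCol n a := by rw [← ha]; ring
  have hb' : -i - 1/2 = -stdCol n b := by rw [← hb]; ring
  set c := Function.update (stdCol n) b (stdCol n a) with hc
  have hca : c a = stdCol n a := by rw [hc, Function.update_of_ne hab]
  have hcb : c b = stdCol n a := by rw [hc, Function.update_self]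
  have entry_a : ∀ x, thetaSum l c x (-stdCol n a) =
      (if x = -l a then 1 else 0) + (if x = -l b then 1 else 0) := by
    intro x
    rw [← thetaSum_neg, neg_neg, hc, thetaSum_merge _ _ hab, if_neg hab, if_pos rfl]
    simp only [neg_eq_iff_eq_neg]
  have entry_b : ∀ x, thetaSum l c x (-stdCol n b) = 0 := by
    intro x
    rw [← thetaSum_neg, neg_neg, hc, thetaSum_merge _ _ hab, if_pos rfl]
  have move_b : matMove (thetaSum l c) (-l b) (-stdCol n b) (-l b) (-stdCol n a) =
      thetaSum l (stdCol n) := by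
    rw [matMove_neg, ← hcb, matMove_thetaSum, hc, Function.update_idem, Function.update_eq_self]
  have move_a : matMove (thetaSum l c) (-l a) (-stdCol n b) (-l a) (-stdCol n a) =
      thetaSum (l ∘ Equiv.swap a b) (stdCol n) := by
    rw [matMove_neg, ← hca, matMove_thetaSum, hc, update_merge_left,
      ← thetaSum_comp_perm l _ (Equiv.swap a b), Function.comp_assoc]
    congr 1
    funext j
    simp
  rw [BRι_tP _ (thetaSum_mem (c := c) hl (update_stdCol_mem a b)), ha', hb']
  simp only [entry_a, entry_b]
  push_cast
  simp only [sub_zero, Finset.sum_add_distrib, sum_filter_lt_ite _ (II_neg (hl _))]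
  by_cases h : l a = l b
  · rw [if_pos h, Finset.sum_eq_single (-l b)]
    · rw [move_b, h]
      simp [one_add_one_eq_two, qint_two]
    · intro j _ hj
      simp [h, hj]
    · exact fun h => absurd (II_neg (hl b)) h
  · have hne : -l a ≠ -l b := by simpa using h
    rw [if_neg h, Finset.sum_eq_add_of_mem (-l a) (-l b) (II_neg (hl a)) (II_neg (hl b)) hne]
    · rw [move_a, move_b]
      simp [hne, hne.symm]
    · intro j _ hj
      simp [hj.1, hj.2]

end RightOperator

theorem Aι_mem {m n : ℕ} {l : Fin n → ℚ} (hl : ∀ j, l j ∈ II (2*m)) : Aι l ∈ Xi0ι m n := by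
  rw [Aι_eq_thetaSum]
  refine ⟨thetaSum_mem hl stdCol_mem, fun y hy => ?_⟩
  obtain ⟨j, rfl | rfl⟩ := exists_stdCol hy
  · simp [thetaSum_stdCol, hl j]
  · have : ∀ x, thetaSum l (stdCol n) x (-stdCol n j) = if x = -l j then 1 else 0 := fun x => by
      rw [← thetaSum_neg, neg_neg, thetaSum_stdCol]
      simp only [neg_eq_iff_eq_neg]
    simp [this, II_neg (hl j)]

theorem exists_eq_Aι {m n : ℕ} {A : Mat} (hA : A ∈ Xi0ι m n) :
    ∃ l : Fin n → SubI (2*m), A = Aι fun r => (l r).1 := by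
  obtain ⟨⟨hsupp, hsymm, -⟩, hcol⟩ := hA
  have h : ∀ j : Fin n, ∃ r : SubI (2*m), ∀ x, A x (stdCol n j) = if x = r.1 then 1 else 0 := by
    intro j
    have hsum := hcol _ (stdCol_mem j)
    obtain ⟨r, hr, hr0⟩ := Finset.exists_ne_zero_of_sum_ne_zero (hsum.trans_ne one_ne_zero)
    have hsplit := Finset.add_sum_erase (II (2*m)) (fun x => A x (stdCol n j)) hr
    refine ⟨⟨r, hr⟩, fun x => ?_⟩
    rcases eq_or_ne x r with rfl | hx
    · simp only [if_true]
      simp only [hsum] at hsplit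
      omega
    · rw [if_neg hx]
      by_contra h0
      have hle := Finset.single_le_sum (f := fun x => A x (stdCol n j))
        (fun _ _ => Nat.zero_le _) (Finset.mem_erase.mpr ⟨hx, (hsupp _ _ h0).1⟩)
      simp only [hsum] at hsplit hle
      omega
  choose l hl using h
  refine ⟨l, ?_⟩
  rw [Aι_eq_thetaSum]
  have hmem := thetaSum_mem (fun j => (l j).2) (stdCol_mem (n := n))
  funext x y
  by_cases hy : y ∈ II (2*n)
  · obtain ⟨j, rfl | rfl⟩ := exists_stdCol hy
    · rw [hl, thetaSum_stdCol]
    · rw [hsymm, ← thetaSum_neg, neg_neg, hl, thetaSum_stdCol]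
  · rw [not_not.mp fun h => hy (hsupp x y h).2, not_not.mp fun h => hy (hmem.1 x y h).2]

theorem Lamι_tT {m n : ℕ} (l : Fin n → SubI (2*m)) :
    Lamι m n (tT l) = tP (Xiι m n n) (thetaSum (fun r => (l r).1) (stdCol n)) := by
  simp [Lamι, tT, Aι_eq_thetaSum]

theorem V0ι_induction {m n : ℕ} {S : Submodule K (FM (Xiι m n n))}
    (h : ∀ l : Fin n → SubI (2*m), Lamι m n (tT l) ∈ S) : V0ι m n ≤ S := by
  refine Submodule.span_le.mpr ?_
  rintro _ ⟨A, hA, rfl⟩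
  obtain ⟨l, rfl⟩ := exists_eq_Aι hA
  rw [Aι_eq_thetaSum, ← Lamι_tT]
  exact h l

theorem Lamι_tT_mem {m n : ℕ} (l : Fin n → SubI (2*m)) : Lamι m n (tT l) ∈ V0ι m n := by
  rw [Lamι_tT, ← Aι_eq_thetaSum]
  exact tP_mem_span (Aι_mem fun j => (l j).2)

theorem swapL_swapL {n M : ℕ} (a b : Fin n) (l : Fin n → SubI M) :
    swapL a b (swapL a b l) = l := by
  funext j; simp [swapL]

theorem apply_apply_eq_smul_of_swap {F V : Type*} [Field F] [AddCommGroup V] [Module F V]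
    {r s : F} (hrs : r * s = 1) {C : Module.End F V} {x y : V}
    (hx : C x = y + r • x) (hy : C y = x + s • y) : C (C x) = (r + s) • C x := by
  rw [hx, map_add, map_smul, hx, hy, add_smul r s, smul_add s, smul_smul s, mul_comm s, hrs]
  module

theorem quadratic_of_apply_apply {F V : Type*} [Field F] [AddCommGroup V] [Module F V]
    {p : F} (hp : p ≠ 0) {C : Module.End F V} {x : V} (h : C (C x) = (p + p⁻¹) • C x) :
    ((1 - p⁻¹ • C + (p ^ (-2 : ℤ)) • 1) * (1 - p⁻¹ • C - 1)) x = 0 := by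
  simp only [Module.End.mul_apply, LinearMap.add_apply, LinearMap.sub_apply,
    LinearMap.smul_apply, Module.End.one_apply, map_sub, map_smul, h]
  match_scalars <;> field_simp <;> ring

section Hecke

variable {m n : ℕ} {a b : Fin n} {i : ℚ}

theorem Ciι_Lamι (hab : a ≠ b) (ha : i - 1/2 = stdCol n a) (hb : i + 1/2 = stdCol n b)
    (l : Fin n → SubI (2*m)) :
    Ciι m n i (Lamι m n (tT l)) =
      if (l a).1 = (l b).1 then (q + q⁻¹) • Lamι m n (tT l)
      else Lamι m n (tT (swapL a b l)) +
        (if (l a).1 < (l b).1 then q else q⁻¹) • Lamι m n (tT l) := by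
  have hcomp : (fun r => (swapL a b l r).1) = (fun r => (l r).1) ∘ Equiv.swap a b := rfl
  rw [Ciι, Module.End.mul_apply, Lamι_tT, BRι_stdCol (fun j => (l j).2) ha hb, map_smul,
    BRι_neg_merge (fun j => (l j).2) hab ha hb, Lamι_tT, hcomp]
  rcases lt_trichotomy (l a).1 (l b).1 with h | h | h
  · simp [h, h.ne, h.not_gt]
  · simp [h]
  · simp [h, h.ne', h.not_gt, smul_smul, q_ne_zero]

theorem Tiι_Lamι (hab : a ≠ b) (ha : i - 1/2 = stdCol n a) (hb : i + 1/2 = stdCol n b)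
    (l : Fin n → SubI (2*m)) :
    (-q) • Tiι m n i (Lamι m n (tT l)) = Lamι m n (sigmaI a b (tT l)) := by
  have hT : (-q) • Tiι m n i (Lamι m n (tT l)) =
      Ciι m n i (Lamι m n (tT l)) - q • Lamι m n (tT l) := by
    simp [Tiι, smul_smul, q_ne_zero, sub_eq_add_neg, add_comm]
  have hσ : sigmaI a b (tT l) = if (l a).1 < (l b).1 then tT (swapL a b l)
      else if (l a).1 = (l b).1 then q⁻¹ • tT l
      else tT (swapL a b l) + (q⁻¹ - q) • tT l := by
    refine (Finsupp.sum_single_index ?_).trans (one_smul K _)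
    exact zero_smul K _
  rw [hT, Ciι_Lamι hab ha hb, hσ]
  rcases lt_trichotomy (l a).1 (l b).1 with h | h | h
  · simp [h, h.ne]
  · simp only [h, lt_irrefl, if_true, if_false, map_smul, ← sub_smul, add_sub_cancel_left]
  · rw [if_neg h.ne', if_neg h.not_gt, if_neg h.not_gt, if_neg h.ne', map_add, map_smul, sub_smul,
      add_sub_assoc]

theorem Ciι_sq_Lamι (hab : a ≠ b) (ha : i - 1/2 = stdCol n a) (hb : i + 1/2 = stdCol n b)
    (l : Fin n → SubI (2*m)) :
    Ciι m n i (Ciι m n i (Lamι m n (tT l))) = (q + q⁻¹) • Ciι m n i (Lamι m n (tT l)) := by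
  have hq := q_ne_zero
  have hsa : swapL a b l a = l b := by simp [swapL]
  have hsb : swapL a b l b = l a := by simp [swapL]
  have h1 := Ciι_Lamι hab ha hb l
  have h2 := Ciι_Lamι hab ha hb (swapL a b l)
  rw [swapL_swapL, hsa, hsb] at h2
  rcases lt_trichotomy (l a).1 (l b).1 with h | h | h
  · simp only [h, h.ne, h.ne', h.not_gt, if_true, if_false] at h1 h2
    exact apply_apply_eq_smul_of_swap (mul_inv_cancel₀ hq) h1 h2
  · simp only [h, if_true] at h1
    rw [h1, map_smul, h1]
  · simp only [h, h.ne, h.ne', h.not_gt, if_true, if_false] at h1 h2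
    rw [add_comm q]
    exact apply_apply_eq_smul_of_swap (inv_mul_cancel₀ hq) h1 h2

theorem Tiι_quadratic (hab : a ≠ b) (ha : i - 1/2 = stdCol n a) (hb : i + 1/2 = stdCol n b)
    {v : FM (Xiι m n n)} (hv : v ∈ V0ι m n) :
    ((Tiι m n i + (q ^ (-2 : ℤ)) • 1) * (Tiι m n i - 1)) v = 0 := by
  refine LinearMap.mem_ker.mp (V0ι_induction (fun l => LinearMap.mem_ker.mpr ?_) hv)
  exact quadratic_of_apply_apply q_ne_zero (Ciι_sq_Lamι hab ha hb l)

end Hecke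

theorem stmt5 (m n : ℕ) (hm : 1 ≤ m) (hn : 2 ≤ n) (i : ℕ) (hi1 : 1 ≤ i) (hi2 : i ≤ n - 1) :
    -- (1) t^{(A)} B^R_i B^R_i = 0 for A ∈ Ξ^{ı,0}
    (∀ A : {A : Mat // A ∈ Xiι m n n}, A.1 ∈ Xi0ι m n →
        BRι m (Xiι m n n) (i : ℚ) (BRι m (Xiι m n n) (i : ℚ) (Finsupp.single A 1)) = 0) ∧
    -- (2) C_i preserves 𝒱^{ı,0}, with explicit formulas on the basis
    (∀ v ∈ V0ι m n, Ciι m n (i : ℚ) v ∈ V0ι m n) ∧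
    (∀ l : Fin n → SubI (2*m),
        ((l ⟨i-1, by omega⟩).1 < (l ⟨i, by omega⟩).1 →
          Ciι m n (i : ℚ) (Lamι m n (tT l))
            = Lamι m n (tT (swapL ⟨i-1, by omega⟩ ⟨i, by omega⟩ l)) + q • Lamι m n (tT l))
      ∧ ((l ⟨i-1, by omega⟩).1 = (l ⟨i, by omega⟩).1 →
          Ciι m n (i : ℚ) (Lamι m n (tT l)) = (q + q⁻¹) • Lamι m n (tT l))
      ∧ ((l ⟨i, by omega⟩).1 < (l ⟨i-1, by omega⟩).1 →
          Ciι m n (i : ℚ) (Lamι m n (tT l))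
            = Lamι m n (tT (swapL ⟨i-1, by omega⟩ ⟨i, by omega⟩ l)) + q⁻¹ • Lamι m n (tT l))) ∧
    -- (3) -q·T_i corresponds to σ_i under Λ^ı, and the Hecke relation holds on 𝒱^{ı,0}
    (∀ l : Fin n → SubI (2*m),
        (-q) • Tiι m n (i : ℚ) (Lamι m n (tT l))
          = Lamι m n (sigmaI ⟨i-1, by omega⟩ ⟨i, by omega⟩ (tT l))) ∧
    (∀ v ∈ V0ι m n, ((Tiι m n (i : ℚ) + (q ^ (-2 : ℤ)) • 1) * (Tiι m n (i : ℚ) - 1)) v = 0) := by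
  have hab : (⟨i-1, by omega⟩ : Fin n) ≠ ⟨i, by omega⟩ := by
    rw [Ne, Fin.mk.injEq]; omega
  have ha : (i : ℚ) - 1/2 = stdCol n ⟨i-1, by omega⟩ := by
    simp only [stdCol]; push_cast [Nat.cast_sub hi1]; ring
  have hb : (i : ℚ) + 1/2 = stdCol n ⟨i, by omega⟩ := rfl
  have hC := fun l => Ciι_Lamι (m := m) hab ha hb l
  refine ⟨?_, ?_, fun l => ⟨fun h => ?_, fun h => ?_, fun h => ?_⟩, Tiι_Lamι hab ha hb,
    fun v hv => Tiι_quadratic hab ha hb hv⟩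
  · rintro ⟨A, hA⟩ hA0
    obtain ⟨l, rfl⟩ := exists_eq_Aι hA0
    have : Finsupp.single (⟨_, hA⟩ : {A : Mat // A ∈ Xiι m n n}) (1 : K) =
        tP (Xiι m n n) (thetaSum (fun r => (l r).1) (stdCol n)) := by
      rw [← Aι_eq_thetaSum, tP, dif_pos hA]
    rw [this, BRι_stdCol (fun j => (l j).2) ha hb, map_smul,
      BRι_merge (fun j => (l j).2) hab hb, smul_zero]
  · refine fun v hv => V0ι_induction (S := (V0ι m n).comap (Ciι m n i)) (fun l => ?_) hv
    rw [Submodule.mem_comap, hC]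
    split_ifs
    · exact Submodule.smul_mem _ _ (Lamι_tT_mem l)
    all_goals
      exact Submodule.add_mem _ (Lamι_tT_mem _) (Submodule.smul_mem _ _ (Lamι_tT_mem l))
  · rw [hC, if_neg h.ne, if_pos h]
  · rw [hC, if_pos h]
  · rw [hC, if_neg h.ne', if_neg h.not_gt]

end
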